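/- Let F be a finite union-closed family of finite sets with ∅ ∈ F whose generators J(F) form a graph, let U = {a, b} ∈ J(F) with a ≠ b, and assume F = 𝒩³_F(U). If every edge V ∈ J'(F) with V ∩ U ≠ ∅ satisfies d_{J'(F)}(V) ≥ d_{J'(F)}(U), then every extension F' of (F, U) satisfies μ_{F,F'}(U) ≥ 2. -/

import Mathlib

open Finset

/-- `F` is union-closed. -/
def UnionClosed {α : Type*} [DecidableEq α] (F : Finset (Finset α)) : Prop :=
  ∀ A ∈ F, ∀ B ∈ F, A ∪ B ∈ F

/-- The generators `J(F)`: nonempty members of `F` that are not the union of the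
members of `F` properly contained in them. -/
def gens {α : Type*} [DecidableEq α] (F : Finset (Finset α)) : Finset (Finset α) :=
  F.filter (fun U => U.Nonempty ∧ (F.filter (fun A => A ⊂ U)).sup id ≠ U)

/-- The closure `π_F(X)`: the union of all members of `F` contained in `X`. -/
def piF {α : Type*} [DecidableEq α] (F : Finset (Finset α)) (X : Finset α) : Finset α :=
  (F.filter (fun A => A ⊆ X)).sup id

/-- `F ∨ H = {A ∪ B : A ∈ F, B ∈ H}`. -/
def famJoin {α : Type*} [DecidableEq α] (F H : Finset (Finset α)) : Finset (Finset α) :=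
  (F ×ˢ H).image (fun p => p.1 ∪ p.2)

/-- `F'` is an extension of `(F, U)`: `F' = F ∨ H` for some nonempty union-closed
family `H` with `(⋃ H) ∩ U = ∅`. -/
def IsExtension {α : Type*} [DecidableEq α] (F : Finset (Finset α)) (U : Finset α)
    (F' : Finset (Finset α)) : Prop :=
  ∃ H : Finset (Finset α), H.Nonempty ∧ UnionClosed H ∧ (H.sup id) ∩ U = ∅ ∧ F' = famJoin F H

/-- The restriction of `F` away from `U`: `F_{∖U} = {A ∖ U : A ∈ F}`. -/
def resAway {α : Type*} [DecidableEq α] (F : Finset (Finset α)) (U : Finset α) :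
    Finset (Finset α) :=
  F.image (fun A => A \ U)

/-- `E_{F,U}(X)`: the subsets `Y ⊆ U` with `π_F(X ∪ Y) ∩ U = Y` and
`π_F(X ∪ Y) ⊇ π_F(X ∪ U) \ U`. -/
def Efam {α : Type*} [DecidableEq α] (F : Finset (Finset α)) (U X : Finset α) :
    Finset (Finset α) :=
  U.powerset.filter (fun Y => piF F (X ∪ Y) ∩ U = Y ∧ piF F (X ∪ U) \ U ⊆ piF F (X ∪ Y))

/-- `μ_{F,F'}(U) = (Σ_{X ∈ F'_{∖U}} |E_{F,U}(X)|) / |F'_{∖U}|`. -/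
def mu {α : Type*} [DecidableEq α] (F : Finset (Finset α)) (U : Finset α)
    (F' : Finset (Finset α)) : ℚ :=
  (∑ X ∈ resAway F' U, ((Efam F U X).card : ℚ)) / ((resAway F' U).card : ℚ)

/-- The union-closed family generated by `G` (all unions of subfamilies of `G`;
it contains `∅` as the empty union). -/
def genUC {α : Type*} [DecidableEq α] (G : Finset (Finset α)) : Finset (Finset α) :=
  G.powerset.image (fun S => S.sup id)

/-- The lattice neighborhood `𝒩_F(U)`: the union-closed family generated by `{∅}`
together with the generators of `F` meeting `U`. -/
def latNbhd {α : Type*} [DecidableEq α] (F : Finset (Finset α)) (U : Finset α) :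
    Finset (Finset α) :=
  genUC ((gens F).filter (fun V => (V ∩ U).Nonempty))

/-- The third lattice neighborhood `𝒩³_F(U) = 𝒩_F(⋃ 𝒩_F(U))`. -/
def latNbhd3 {α : Type*} [DecidableEq α] (F : Finset (Finset α)) (U : Finset α) :
    Finset (Finset α) :=
  latNbhd F ((latNbhd F U).sup id)

/-- The neighborhood `N_F(X) = X ∪ ⋃ {V ∈ J(F) : V ∩ X ≠ ∅}`. -/
def nbhd {α : Type*} [DecidableEq α] (F : Finset (Finset α)) (X : Finset α) : Finset α :=
  X ∪ ((gens F).filter (fun V => (V ∩ X).Nonempty)).sup id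

/-- `H` is a filter of `2^S`: a nonempty family of subsets of `S` closed upward in `S`. -/
def IsFilterOn {α : Type*} [DecidableEq α] (S : Finset α) (H : Finset (Finset α)) : Prop :=
  H.Nonempty ∧ (∀ X ∈ H, X ⊆ S) ∧ ∀ X ∈ H, ∀ Y, X ⊆ Y → Y ⊆ S → Y ∈ H

/-- `F'` minimizes `μ` in `D` (among extensions of `(F, U)` with union inside `D`). -/
def MinimizesMu {α : Type*} [DecidableEq α] (F : Finset (Finset α)) (U D : Finset α)
    (F' : Finset (Finset α)) : Prop :=
  F'.sup id ⊆ D ∧ ∀ F'', IsExtension F U F'' → F''.sup id ⊆ D → mu F U F' ≤ mu F U F''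

/-- The degree of `U` in the graph `G`: the number of members of `G` other than `U`
meeting `U`. -/
def degG {α : Type*} [DecidableEq α] (G : Finset (Finset α)) (U : Finset α) : ℕ :=
  (G.filter (fun V => V ≠ U ∧ (V ∩ U).Nonempty)).card

/-- The members of `C` that lie in `X` all have a neighbor in `X`. -/
def AllJoined {α : Type*} [DecidableEq α] (N : α → Finset α) (C X : Finset α) : Prop :=
  ∀ c ∈ C, c ∈ X → (N c ∩ X).Nonempty

/-- Every member of `C`, whether in `X` or not, has a neighbor in `X`. -/
def Dominates {α : Type*} [DecidableEq α] (N : α → Finset α) (C X : Finset α) : Prop :=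
  ∀ c ∈ C, (N c ∩ X).Nonempty

open Classical in
/-- A lower bound for `|E_{F,U}(X)|` when `A` and `B` are the neighborhoods of the endpoints
of `U`. -/
noncomputable def traceCount {α : Type*} [DecidableEq α] (N : α → Finset α) (A B X : Finset α) :
    ℕ :=
  1 + (if AllJoined N (A ∪ B) X then 1 else 0) +
    (if (X ∩ A).Nonempty ∧ AllJoined N (B \ A) X then 1 else 0) +
    (if (X ∩ B).Nonempty ∧ AllJoined N (A \ B) X then 1 else 0)

theorem Dominates.allJoined {α : Type*} [DecidableEq α] {N : α → Finset α} {C X : Finset α}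
    (h : Dominates N C X) : AllJoined N C X :=
  fun c hc _ => h c hc

theorem add_sub_mul_pow_ge {x y : ℚ} (hx0 : 0 ≤ x) (hx1 : x ≤ 1) (hy0 : 0 ≤ y) (hy1 : y ≤ 1)
    (p : ℕ) : x ^ p + y ^ p - x ^ p * y ^ p ≤ (x + y - x * y) ^ p := by
  induction p with
  | zero => simp
  | succ p ih =>
    have hX0 : 0 ≤ x ^ p := pow_nonneg hx0 p
    have hY0 : 0 ≤ y ^ p := pow_nonneg hy0 p
    have hX1 : 0 ≤ 1 - x ^ p := sub_nonneg.2 (pow_le_one₀ hx0 hx1)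
    have hY1 : 0 ≤ 1 - y ^ p := sub_nonneg.2 (pow_le_one₀ hy0 hy1)
    have hx : 0 ≤ 1 - x := sub_nonneg.2 hx1
    have hy : 0 ≤ 1 - y := sub_nonneg.2 hy1
    have hs : 0 ≤ x + y - x * y := by nlinarith [mul_nonneg hy0 hx]
    have h1 : 0 ≤ x * y ^ p * (1 - x ^ p) * (1 - y) := by positivity
    have h2 : 0 ≤ y * x ^ p * (1 - y ^ p) * (1 - x) := by positivity
    have h3 := mul_le_mul_of_nonneg_right ih hs
    simp only [pow_succ]
    linarith

theorem one_le_pow_sub_add_pow_sub {u : ℚ} (hu0 : 0 ≤ u) (hu1 : u ≤ 1) {p : ℕ} (hp : p ≠ 0)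
    (q : ℕ) : 1 ≤ (1 - u ^ q) ^ p + (1 - (1 - u) ^ p) ^ q := by
  induction q with
  | zero => simp [hp]
  | succ q ih =>
    have hv : (1 - u) ^ p ≤ 1 := pow_le_one₀ (by linarith) (by linarith)
    have ht : u ^ q ≤ 1 := pow_le_one₀ hu0 hu1
    have h := add_sub_mul_pow_ge (x := 1 - u) (y := 1 - u ^ q) (by linarith) (by linarith)
      (by linarith) (by linarith [pow_nonneg hu0 q]) p
    rw [show 1 - u + (1 - u ^ q) - (1 - u) * (1 - u ^ q) = 1 - u ^ (q + 1) by ring] at h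
    rw [pow_succ (1 - (1 - u) ^ p)]
    nlinarith [mul_le_mul_of_nonneg_right ih (sub_nonneg.2 hv)]

theorem union_mem_of_insert_mem {α : Type*} [DecidableEq α] {W : Finset (Finset α)}
    {X Q : Finset α} (hX : X ∈ W) (hW : ∀ X ∈ W, ∀ e ∈ Q, insert e X ∈ W) : X ∪ Q ∈ W := by
  induction Q using Finset.induction_on with
  | empty => simpa
  | insert e Q _ ih =>
    rw [union_insert]
    exact hW _ (ih fun X hX f hf => hW X hX f (mem_insert_of_mem hf)) e (mem_insert_self e Q)

theorem two_pow_mul_card_disjoint_le {α : Type*} [DecidableEq α] {W : Finset (Finset α)}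
    {K : Finset α} (hW : ∀ X ∈ W, ∀ e ∈ K, insert e X ∈ W) :
    2 ^ #K * #{X ∈ W | ¬ (K ∩ X).Nonempty} ≤ #W := by
  rw [← card_powerset, ← card_product]
  refine card_le_card_of_injOn (fun p => p.2 ∪ p.1) ?_ ?_
  · rintro ⟨Q, X⟩ h
    simp only [coe_product, Set.mem_prod, mem_coe, mem_powerset, mem_filter] at h
    exact union_mem_of_insert_mem h.2.1 fun X hX e he => hW X hX e (h.1 he)
  · rintro ⟨Q, X⟩ h ⟨Q', X'⟩ h' heq
    simp only [coe_product, Set.mem_prod, mem_coe, mem_powerset, mem_filter,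
      not_nonempty_iff_eq_empty, ← disjoint_iff_inter_eq_empty] at h h' heq
    have hX : ∀ {Q X : Finset α}, Q ⊆ K → Disjoint K X → (X ∪ Q) \ K = X := by
      intro Q X hQ hd
      rw [union_sdiff_distrib, sdiff_eq_empty_iff_subset.2 hQ, union_empty,
        sdiff_eq_self_of_disjoint hd.symm]
    have hQ : ∀ {Q X : Finset α}, Q ⊆ K → Disjoint K X → (X ∪ Q) ∩ K = Q := by
      intro Q X hQ hd
      rw [union_inter_distrib_right, inter_eq_left.2 hQ, inter_comm,
        disjoint_iff_inter_eq_empty.1 hd, empty_union]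
    rw [Prod.mk.injEq]
    exact ⟨by rw [← hQ h.1 h.2.2, heq, hQ h'.1 h'.2.2],
      by rw [← hX h.1 h.2.2, heq, hX h'.1 h'.2.2]⟩

open Classical in
theorem pow_mul_card_le_card_dominates {α : Type*} [DecidableEq α] (N : α → Finset α) (q : ℕ)
    (C : Finset α) (hq : ∀ c ∈ C, q ≤ #(N c)) (W : Finset (Finset α))
    (hW : ∀ X ∈ W, ∀ c ∈ C, ∀ e ∈ N c, insert e X ∈ W) :
    (1 - (1 / 2 : ℚ) ^ q) ^ #C * #W ≤ #{X ∈ W | Dominates N C X} := by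
  induction C using Finset.induction_on with
  | empty => simp [Dominates]
  | insert c C hc ih =>
    have hrec := ih (fun d hd => hq d (mem_insert_of_mem hd))
      fun X hX d hd => hW X hX d (mem_insert_of_mem hd)
    set V := {X ∈ W | Dominates N C X} with hV
    have hVup : ∀ X ∈ V, ∀ e ∈ N c, insert e X ∈ V := by
      intro X hX e he
      rw [hV, mem_filter] at hX ⊢
      exact ⟨hW X hX.1 c (mem_insert_self c C) e he, fun d hd =>
        (hX.2 d hd).mono (inter_subset_inter_left (subset_insert e X))⟩
    have hle := two_pow_mul_card_disjoint_le hVup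
    have hsplit := card_filter_add_card_filter_not (s := V) (fun X => (N c ∩ X).Nonempty)
    have heq : {X ∈ W | Dominates N (insert c C) X} = {X ∈ V | (N c ∩ X).Nonempty} := by
      rw [hV, filter_filter]
      refine filter_congr fun X _ => ?_
      simp only [Dominates, forall_mem_insert]
      exact and_comm
    rw [heq, card_insert_of_notMem hc, pow_succ]
    have hle' : (2 : ℚ) ^ q * #{X ∈ V | ¬ (N c ∩ X).Nonempty} ≤ #V := by
      have hle' : (2 : ℚ) ^ #(N c) * #{X ∈ V | ¬ (N c ∩ X).Nonempty} ≤ #V := by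
        exact_mod_cast hle
      refine le_trans ?_ hle'
      gcongr
      · norm_num
      · exact hq c (mem_insert_self c C)
    have hmiss : (#{X ∈ V | ¬ (N c ∩ X).Nonempty} : ℚ) ≤ (1 / 2) ^ q * #V := by
      rw [one_div, inv_pow, ← div_eq_inv_mul, le_div_iff₀ (by positivity)]
      linarith
    have hs : (#{X ∈ V | (N c ∩ X).Nonempty} : ℚ) + #{X ∈ V | ¬ (N c ∩ X).Nonempty} = #V := by
      exact_mod_cast hsplit
    have h1 : (0 : ℚ) ≤ 1 - (1 / 2) ^ q :=
      sub_nonneg.2 (pow_le_one₀ (by norm_num) (by norm_num))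
    nlinarith [mul_le_mul_of_nonneg_left hrec h1]

/-- Compressing upwards along the directions in `D` keeps the sums of all functions that do not
see an inserted element outside `C` with no neighbor in `C`. -/
theorem exists_compression {α : Type*} [DecidableEq α] (N : α → Finset α) (C D : Finset α)
    (hD : Disjoint C D) (W : Finset (Finset α)) (hC : ∀ X ∈ W, ∀ e ∈ C, insert e X ∈ W)
    (hN : ∀ X ∈ W, ∀ c ∈ C, c ∈ X → ∀ e ∈ N c, insert e X ∈ W) :
    ∃ V : Finset (Finset α), (∀ X ∈ V, ∀ e ∈ C, insert e X ∈ V) ∧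
      (∀ X ∈ V, ∀ c ∈ C, c ∈ X → ∀ e ∈ N c, insert e X ∈ V) ∧
      (∀ X ∈ V, ∀ e ∈ D, insert e X ∈ V) ∧
      ∀ f : Finset α → ℕ,
        (∀ X, ∀ e ∉ C, (∀ c ∈ C, c ∈ X → e ∉ N c) → f (insert e X) = f X) →
        ∑ X ∈ V, f X = ∑ X ∈ W, f X := by
  induction D using Finset.induction_on with
  | empty => exact ⟨W, hC, hN, by simp, fun _ _ => rfl⟩
  | insert e D _ ih =>
    rw [disjoint_insert_right] at hD
    obtain ⟨V, hVC, hVN, hVD, hVf⟩ := ih hD.2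
    set V' := {X ∈ V | insert e X ∈ V} ∪ {X ∈ V | insert e X ∉ V}.image (insert e) with hV'
    have hins : ∀ X ∈ V, insert e X ∈ V' := by
      intro X hX
      by_cases h : insert e X ∈ V
      · exact mem_union_left _ (mem_filter.2 ⟨h, by rwa [insert_idem]⟩)
      · exact mem_union_right _ (mem_image_of_mem _ (mem_filter.2 ⟨hX, h⟩))
    have hcases : ∀ Y ∈ V', (Y ∈ V ∧ insert e Y ∈ V) ∨ ∃ X ∈ V, insert e X = Y := by
      intro Y hY
      rcases mem_union.1 hY with h | h
      · exact Or.inl (mem_filter.1 h)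
      · obtain ⟨X, hX, rfl⟩ := mem_image.1 h
        exact Or.inr ⟨X, (mem_filter.1 hX).1, rfl⟩
    have hdir : ∀ t, (∀ X ∈ V, insert t X ∈ V) → ∀ Y ∈ V', insert t Y ∈ V' := by
      intro t ht Y hY
      rcases hcases Y hY with ⟨h1, h2⟩ | ⟨X, hX, rfl⟩
      · refine mem_union_left _ (mem_filter.2 ⟨ht Y h1, ?_⟩)
        rw [Finset.insert_comm]
        exact ht _ h2
      · rw [Finset.insert_comm]
        exact hins _ (ht X hX)
    refine ⟨V', fun Y hY t ht => hdir t (fun X hX => hVC X hX t ht) Y hY, ?_, ?_, ?_⟩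
    · intro Y hY c hc hcY t ht
      rcases hcases Y hY with ⟨h1, h2⟩ | ⟨X, hX, rfl⟩
      · refine mem_union_left _ (mem_filter.2 ⟨hVN Y h1 c hc hcY t ht, ?_⟩)
        rw [Finset.insert_comm]
        exact hVN _ h2 c hc (mem_insert_of_mem hcY) t ht
      · have hcX : c ∈ X := (mem_insert.1 hcY).resolve_left fun h => hD.1 (h ▸ hc)
        rw [Finset.insert_comm]
        exact hins _ (hVN X hX c hc hcX t ht)
    · intro Y hY t ht
      rcases mem_insert.1 ht with rfl | ht
      · rcases hcases Y hY with ⟨h1, _⟩ | ⟨X, hX, rfl⟩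
        · exact hins Y h1
        · rwa [insert_idem]
      · exact hdir t (fun X hX => hVD X hX t ht) Y hY
    · intro f hf
      rw [← hVf f hf, hV', sum_union, sum_image,
        ← sum_filter_add_sum_filter_not V (fun X => insert e X ∈ V)]
      · congr 1
        refine sum_congr rfl fun X hX => hf X e hD.1 fun c hc hcX hec => ?_
        exact (mem_filter.1 hX).2 (hVN X (mem_filter.1 hX).1 c hc hcX e hec)
      · have hmem : ∀ X ∈ ({X ∈ V | insert e X ∉ V} : Finset (Finset α)), e ∉ X := by
          intro X hX heX
          rw [mem_filter, insert_eq_of_mem heX] at hX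
          exact hX.2 hX.1
        intro X hX Y hY hXY
        rw [← erase_insert (hmem X hX), hXY, erase_insert (hmem Y hY)]
      · rw [disjoint_left]
        intro Y hY hY'
        obtain ⟨X, hX, rfl⟩ := mem_image.1 hY'
        exact (mem_filter.1 hX).2 (mem_filter.1 hY).1

theorem traceCount_insert {α : Type*} [DecidableEq α] {N : α → Finset α} {A B X : Finset α} {e : α}
    (he : e ∉ A ∪ B) (hN : ∀ c ∈ A ∪ B, c ∈ X → e ∉ N c) :
    traceCount N A B (insert e X) = traceCount N A B X := by
  have hJ : ∀ C ⊆ A ∪ B, (AllJoined N C (insert e X) ↔ AllJoined N C X) := by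
    intro C hC
    refine forall₂_congr fun c hc => ?_
    have hce : c ≠ e := fun h => he (h ▸ hC hc)
    simp only [mem_insert, hce, false_or]
    exact forall_congr' fun hcX => by rw [inter_insert_of_notMem (hN c (hC hc) hcX)]
  rw [mem_union, not_or] at he
  have h1 := hJ (A ∪ B) subset_rfl
  have h2 := hJ (A \ B) (sdiff_subset.trans subset_union_left)
  have h3 := hJ (B \ A) (sdiff_subset.trans subset_union_right)
  rw [traceCount, traceCount, propext h1, propext h2, propext h3, insert_inter_of_notMem he.1,
    insert_inter_of_notMem he.2]

theorem allJoined_union_iff {α : Type*} [DecidableEq α] {N : α → Finset α} {A B X : Finset α} :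
    AllJoined N (A ∪ B) X ↔ AllJoined N A X ∧ AllJoined N B X := by
  simp only [AllJoined, mem_union, or_imp, forall_and]

theorem AllJoined.mono {α : Type*} [DecidableEq α] {N : α → Finset α} {C C' X : Finset α}
    (hC : C ⊆ C') (h : AllJoined N C' X) : AllJoined N C X :=
  fun c hc => h c (hC hc)

theorem allJoined_of_inter_eq_empty {α : Type*} [DecidableEq α] {N : α → Finset α}
    {C X : Finset α} (h : ¬ (X ∩ C).Nonempty) : AllJoined N C X :=
  fun c hc hcX => absurd ⟨c, mem_inter.2 ⟨hcX, hc⟩⟩ h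

theorem traceCount_comm {α : Type*} [DecidableEq α] (N : α → Finset α) (A B X : Finset α) :
    traceCount N A B X = traceCount N B A X := by
  rw [traceCount, traceCount, union_comm]
  ring

theorem two_le_traceCount {α : Type*} [DecidableEq α] {N : α → Finset α} {A B X : Finset α}
    (h : AllJoined N (A \ B) X) : 2 ≤ traceCount N A B X := by
  by_cases hAB : AllJoined N (A ∪ B) X
  · simp only [traceCount, hAB, if_true]
    omega
  · have hXB : (X ∩ B).Nonempty := by
      by_contra hB
      rw [← sdiff_union_self_eq_union, allJoined_union_iff] at hAB
      exact hAB ⟨h, allJoined_of_inter_eq_empty hB⟩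
    simp only [traceCount, hXB, h, and_self, if_true]
    omega

theorem three_le_traceCount {α : Type*} [DecidableEq α] {N : α → Finset α} {A B X : Finset α}
    (hA : AllJoined N (A \ B) X) (hB : AllJoined N (B \ A) X) (hX : (X ∩ (A ∪ B)).Nonempty) :
    3 ≤ traceCount N A B X := by
  by_cases hXA : (X ∩ A).Nonempty <;> by_cases hXB : (X ∩ B).Nonempty
  · simp only [traceCount, hXA, hXB, hA, hB, and_self, if_true]
    omega
  · have hJ : AllJoined N (A ∪ B) X := by
      rw [← sdiff_union_self_eq_union, allJoined_union_iff]
      exact ⟨hA, allJoined_of_inter_eq_empty hXB⟩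
    simp only [traceCount, hXA, hB, hJ, and_self, if_true]
    omega
  · have hJ : AllJoined N (A ∪ B) X := by
      rw [union_comm, ← sdiff_union_self_eq_union, allJoined_union_iff]
      exact ⟨hB, allJoined_of_inter_eq_empty hXA⟩
    simp only [traceCount, hXB, hA, hJ, and_self, if_true]
    omega
  · rw [inter_union_distrib_left, union_nonempty] at hX
    exact absurd hX (by tauto)

open Classical in
/-- Among the members of a family closed under insertion, the average of `traceCount` is at
least `2`. -/
theorem two_mul_card_le_sum_traceCount_of_upper {α : Type*} [DecidableEq α] {N : α → Finset α}
    {A B : Finset α} (hA : (A \ B).Nonempty) (hB : (B \ A).Nonempty)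
    (hNA : ∀ c ∈ A \ B, #B ≤ #(N c)) (hNB : ∀ c ∈ B \ A, #A ≤ #(N c))
    (W : Finset (Finset α)) (hC : ∀ X ∈ W, ∀ e ∈ A ∪ B, insert e X ∈ W)
    (hN : ∀ X ∈ W, ∀ c ∈ A ∪ B, ∀ e ∈ N c, insert e X ∈ W) :
    2 * #W ≤ ∑ X ∈ W, traceCount N A B X := by
  set K := {X ∈ W | ¬ (X ∩ (A ∪ B)).Nonempty ∧ Dominates N (A \ B) X ∧ Dominates N (B \ A) X}
    with hK
  set L := K.image (fun X => X ∪ (A \ B ∪ B \ A)) with hL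
  have hLW : L ⊆ W := by
    intro Y hY
    obtain ⟨X, hX, rfl⟩ := mem_image.1 hY
    refine union_mem_of_insert_mem (mem_filter.1 hX).1 fun Z hZ e he => hC Z hZ e ?_
    rcases mem_union.1 he with h | h
    · exact mem_union_left _ (mem_sdiff.1 h).1
    · exact mem_union_right _ (mem_sdiff.1 h).1
  have hKW : K ⊆ W := filter_subset _ _
  have hcard : #L = #K := by
    refine card_image_of_injOn fun X hX Y hY hXY => ?_
    have hd : ∀ Z ∈ K, (Z ∪ (A \ B ∪ B \ A)) \ (A ∪ B) = Z := by
      intro Z hZ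
      have hZ' := (mem_filter.1 hZ).2.1
      rw [not_nonempty_iff_eq_empty, ← disjoint_iff_inter_eq_empty] at hZ'
      rw [union_sdiff_distrib, sdiff_eq_self_of_disjoint hZ', sdiff_eq_empty_iff_subset.2,
        union_empty]
      exact union_subset (sdiff_subset.trans subset_union_left)
        (sdiff_subset.trans subset_union_right)
    rw [← hd X hX, hXY, hd Y hY]
  have hpoint : ∀ X ∈ W, ((if Dominates N (A \ B) X then 1 else 0) +
      (if Dominates N (B \ A) X then 1 else 0) + (if X ∈ L then 1 else 0) + 1 : ℕ) ≤
      traceCount N A B X + (if X ∈ K then 1 else 0) := by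
    intro X hX
    by_cases hXL : X ∈ L
    · obtain ⟨Y, hY, rfl⟩ := mem_image.1 hXL
      obtain ⟨-, hYe, hYA, hYB⟩ := mem_filter.1 hY
      have hdom : ∀ {C}, Dominates N C Y → Dominates N C (Y ∪ (A \ B ∪ B \ A)) :=
        fun h c hc => (h c hc).mono (inter_subset_inter_left subset_union_left)
      have hJ : AllJoined N (A ∪ B) (Y ∪ (A \ B ∪ B \ A)) := by
        intro c hc hcY
        rcases mem_union.1 hcY with h | h
        · exact absurd ⟨c, mem_inter.2 ⟨h, hc⟩⟩ hYe
        · rcases mem_union.1 h with h | h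
          · exact hdom hYA c h
          · exact hdom hYB c h
      have hXA : ((Y ∪ (A \ B ∪ B \ A)) ∩ A).Nonempty := by
        obtain ⟨c, hc⟩ := hA
        exact ⟨c, mem_inter.2 ⟨mem_union_right _ (mem_union_left _ hc), (mem_sdiff.1 hc).1⟩⟩
      have hXB : ((Y ∪ (A \ B ∪ B \ A)) ∩ B).Nonempty := by
        obtain ⟨c, hc⟩ := hB
        exact ⟨c, mem_inter.2 ⟨mem_union_right _ (mem_union_right _ hc), (mem_sdiff.1 hc).1⟩⟩
      simp only [traceCount, hJ, hXA, hXB, (hdom hYA).allJoined, (hdom hYB).allJoined, hXL,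
        hdom hYA, hdom hYB, and_self, if_true]
      omega
    · by_cases hXA : Dominates N (A \ B) X <;> by_cases hXB : Dominates N (B \ A) X
      · by_cases hXe : (X ∩ (A ∪ B)).Nonempty
        · have h3 := three_le_traceCount hXA.allJoined hXB.allJoined hXe
          simp only [hXL, hXA, hXB, if_true, if_false]
          omega
        · have h2 := two_le_traceCount (B := B) hXA.allJoined
          have hXK : X ∈ K := mem_filter.2 ⟨hX, hXe, hXA, hXB⟩
          simp only [hXL, hXA, hXB, hXK, if_true, if_false]
          omega
      · have h2 := two_le_traceCount (B := B) hXA.allJoined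
        simp only [hXL, hXA, hXB, if_true, if_false]
        omega
      · have h2 := two_le_traceCount (B := A) hXB.allJoined
        rw [traceCount_comm] at h2
        simp only [hXL, hXA, hXB, if_true, if_false]
        omega
      · simp only [traceCount, hXL, hXA, hXB, if_false]
        omega
  have hsum := sum_le_sum hpoint
  simp only [sum_add_distrib, ← card_filter, sum_const, smul_eq_mul, mul_one] at hsum
  rw [filter_mem_eq_inter, filter_mem_eq_inter, inter_eq_right.2 hLW,
    inter_eq_right.2 hKW, hcard] at hsum
  have hp : #A ≠ 0 := by
    obtain ⟨c, hc⟩ := hA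
    exact card_ne_zero_of_mem (mem_sdiff.1 hc).1
  have hineq := one_le_pow_sub_add_pow_sub (u := 1 / 2) (by norm_num) (by norm_num) hp #B
  rw [show (1 : ℚ) - 1 / 2 = 1 / 2 by norm_num] at hineq
  have hbound : ∀ C C' : Finset α, C \ C' ⊆ A ∪ B → (∀ c ∈ C \ C', #C' ≤ #(N c)) →
      (1 - (1 / 2 : ℚ) ^ #C') ^ #C * #W ≤ #{X ∈ W | Dominates N (C \ C') X} := by
    intro C C' hCC' hq
    refine le_trans ?_ (pow_mul_card_le_card_dominates N #C' (C \ C') hq W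
      fun X hX c hc => hN X hX c (hCC' hc))
    refine mul_le_mul_of_nonneg_right ?_ (Nat.cast_nonneg _)
    exact pow_le_pow_of_le_one (sub_nonneg.2 (pow_le_one₀ (by norm_num) (by norm_num)))
      (sub_le_self _ (by positivity)) (card_le_card sdiff_subset)
  have h1 := hbound A B (sdiff_subset.trans subset_union_left) hNA
  have h2 := hbound B A (sdiff_subset.trans subset_union_right) hNB
  have h3 : (#W : ℚ) ≤ #{X ∈ W | Dominates N (A \ B) X} + #{X ∈ W | Dominates N (B \ A) X} := by
    nlinarith [mul_le_mul_of_nonneg_right hineq (Nat.cast_nonneg (α := ℚ) #W)]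
  have h4 : #W ≤ #{X ∈ W | Dominates N (A \ B) X} + #{X ∈ W | Dominates N (B \ A) X} := by
    exact_mod_cast h3
  omega

theorem two_mul_card_le_sum_traceCount {α : Type*} [DecidableEq α] {N : α → Finset α}
    {A B : Finset α} (hNA : ∀ c ∈ A \ B, #B ≤ #(N c)) (hNB : ∀ c ∈ B \ A, #A ≤ #(N c))
    (W : Finset (Finset α)) (hC : ∀ X ∈ W, ∀ e ∈ A ∪ B, insert e X ∈ W)
    (hN : ∀ X ∈ W, ∀ c ∈ A ∪ B, c ∈ X → ∀ e ∈ N c, insert e X ∈ W) :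
    2 * #W ≤ ∑ X ∈ W, traceCount N A B X := by
  rcases (A \ B).eq_empty_or_nonempty with hA | hA
  · rw [mul_comm, ← smul_eq_mul]
    exact card_nsmul_le_sum _ _ _ fun X _ => two_le_traceCount (by simp [hA, AllJoined])
  rcases (B \ A).eq_empty_or_nonempty with hB | hB
  · rw [mul_comm, ← smul_eq_mul]
    refine card_nsmul_le_sum _ _ _ fun X _ => ?_
    rw [traceCount_comm]
    exact two_le_traceCount (by simp [hB, AllJoined])
  obtain ⟨V, hVC, -, hVD, hVf⟩ := exists_compression N (A ∪ B) ((A ∪ B).biUnion N \ (A ∪ B))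
    disjoint_sdiff W hC hN
  have hcard : #V = #W := by
    simpa using hVf (fun _ => 1) fun _ _ _ _ => rfl
  rw [← hcard, ← hVf _ fun X e he h => traceCount_insert he h]
  refine two_mul_card_le_sum_traceCount_of_upper hA hB hNA hNB V hVC fun X hX c hc e he => ?_
  by_cases h : e ∈ A ∪ B
  · exact hVC X hX e h
  · exact hVD X hX e (mem_sdiff.2 ⟨mem_biUnion.2 ⟨c, hc, he⟩, h⟩)

/-- The neighbors of `u` in the graph `G`. -/
def graphNbrs {α : Type*} [DecidableEq α] (G : Finset (Finset α)) (u : α) : Finset α :=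
  (G.sup id).filter (fun x => x ≠ u ∧ {u, x} ∈ G)

theorem mem_graphNbrs {α : Type*} [DecidableEq α] {G : Finset (Finset α)} {u x : α} :
    x ∈ graphNbrs G u ↔ x ≠ u ∧ {u, x} ∈ G := by
  rw [graphNbrs, mem_filter, and_iff_right_iff_imp]
  rintro ⟨-, h⟩
  exact mem_sup.2 ⟨_, h, by simp⟩

theorem mem_graphNbrs_comm {α : Type*} [DecidableEq α] {G : Finset (Finset α)} {u x : α} :
    x ∈ graphNbrs G u ↔ u ∈ graphNbrs G x := by
  rw [mem_graphNbrs, mem_graphNbrs, pair_comm, ne_comm]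

theorem degG_pair {α : Type*} [DecidableEq α] {G : Finset (Finset α)} (hG : ∀ V ∈ G, #V = 2)
    {u v : α} (huv : u ≠ v) :
    degG G {u, v} = #((graphNbrs G u).erase v) + #((graphNbrs G v).erase u) := by
  have hinj : ∀ w : α, ∀ C : Finset α, w ∉ C → #(C.image fun x => ({w, x} : Finset α)) = #C := by
    intro w C hw
    refine card_image_of_injOn fun x hx y hy hxy => ?_
    have hxw : x ∈ ({w, y} : Finset α) := by
      rw [← show ({w, x} : Finset α) = {w, y} from hxy]
      simp
    rcases mem_insert.1 hxw with rfl | h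
    · exact absurd hx hw
    · exact mem_singleton.1 h
  rw [← hinj u ((graphNbrs G u).erase v) (by simp [mem_graphNbrs]),
    ← hinj v ((graphNbrs G v).erase u) (by simp [mem_graphNbrs]), ← card_union_of_disjoint, degG]
  · congr 1
    ext V
    simp only [mem_filter, mem_union, mem_image, mem_erase, mem_graphNbrs]
    constructor
    · rintro ⟨hV, hne, w, hw⟩
      rw [mem_inter, mem_insert, mem_singleton] at hw
      obtain ⟨x, y, hxy, rfl⟩ := card_eq_two.1 (hG V hV)
      obtain ⟨hwV, rfl | rfl⟩ := hw
      · left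
        rcases mem_insert.1 hwV with rfl | h
        · exact ⟨y, ⟨fun h => hne (by rw [h]), hxy.symm, hV⟩, rfl⟩
        · obtain rfl := mem_singleton.1 h
          rw [pair_comm] at hV hne ⊢
          exact ⟨x, ⟨fun h => hne (by rw [h]), hxy, hV⟩, rfl⟩
      · right
        rcases mem_insert.1 hwV with rfl | h
        · exact ⟨y, ⟨fun h => hne (by rw [h, pair_comm]), hxy.symm, hV⟩, rfl⟩
        · obtain rfl := mem_singleton.1 h
          rw [pair_comm] at hV ⊢
          exact ⟨x, ⟨fun h => hne (by rw [h]), hxy, hV⟩, rfl⟩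
    · rintro (⟨x, ⟨hxv, hxu, hV⟩, rfl⟩ | ⟨x, ⟨hxu, hxv, hV⟩, rfl⟩)
      · refine ⟨hV, fun h => ?_, u, by simp⟩
        have : x ∈ ({u, v} : Finset α) := by rw [← h]; simp
        simp [hxu, hxv] at this
      · refine ⟨hV, fun h => ?_, v, by simp⟩
        have : x ∈ ({u, v} : Finset α) := by rw [← h]; simp
        simp [hxu, hxv] at this
  · rw [disjoint_left]
    intro V hV hV'
    obtain ⟨x, hx, rfl⟩ := mem_image.1 hV
    obtain ⟨y, hy, hxy⟩ := mem_image.1 hV'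
    have hv : v ∈ ({u, x} : Finset α) := by rw [← hxy]; simp
    rcases mem_insert.1 hv with h | h
    · exact huv h.symm
    · exact (mem_erase.1 hx).1 (mem_singleton.1 h).symm

theorem card_erase_le_card_graphNbrs {α : Type*} [DecidableEq α] {G : Finset (Finset α)}
    (hG : ∀ V ∈ G, #V = 2) {a b c : α} (hab : a ≠ b) (hb : b ∈ graphNbrs G a)
    (hc : c ∈ (graphNbrs G a).erase b) (hcb : c ∉ (graphNbrs G b).erase a)
    (hdeg : degG G {a, b} ≤ degG G {a, c}) :
    #((graphNbrs G b).erase a) ≤ #(((graphNbrs G c).erase a).erase b) := by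
  have hca : c ∈ graphNbrs G a := mem_of_mem_erase hc
  have hac : c ≠ a := (mem_graphNbrs.1 hca).1
  rw [degG_pair hG hab, degG_pair hG hac.symm, card_erase_of_mem hb, card_erase_of_mem hca] at hdeg
  rw [erase_eq_of_notMem (a := b)]
  · omega
  · intro h
    exact hcb (mem_erase.2 ⟨hac, mem_graphNbrs_comm.1 (mem_of_mem_erase h)⟩)

theorem mem_piF {α : Type*} [DecidableEq α] {F : Finset (Finset α)} {X : Finset α} {x : α} :
    x ∈ piF F X ↔ ∃ P ∈ F, P ⊆ X ∧ x ∈ P := by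
  simp only [piF, mem_sup, mem_filter, id, and_assoc]

theorem piF_subset {α : Type*} [DecidableEq α] (F : Finset (Finset α)) (X : Finset α) :
    piF F X ⊆ X := by
  intro x hx
  obtain ⟨P, -, hPX, hxP⟩ := mem_piF.1 hx
  exact hPX hxP

theorem exists_gens_of_mem {α : Type*} [DecidableEq α] {F : Finset (Finset α)} {P : Finset α}
    (hP : P ∈ F) {x : α} (hx : x ∈ P) : ∃ V ∈ gens F, V ⊆ P ∧ x ∈ V := by
  induction P using Finset.strongInduction with
  | H P ih =>
    by_cases h : ∃ Q ∈ F, Q ⊂ P ∧ x ∈ Q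
    · obtain ⟨Q, hQ, hQP, hxQ⟩ := h
      obtain ⟨V, hV, hVQ, hxV⟩ := ih Q hQP hQ hxQ
      exact ⟨V, hV, hVQ.trans hQP.subset, hxV⟩
    · refine ⟨P, mem_filter.2 ⟨hP, ⟨x, hx⟩, fun hsup => h ?_⟩, subset_rfl, hx⟩
      rw [← hsup, mem_sup] at hx
      obtain ⟨Q, hQ, hxQ⟩ := hx
      exact ⟨Q, (mem_filter.1 hQ).1, (mem_filter.1 hQ).2, hxQ⟩

section Graph

variable {α : Type*} [DecidableEq α] {F : Finset (Finset α)}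

/-- The edges of the graph `J(F)`. -/
def edgeGens (F : Finset (Finset α)) : Finset (Finset α) :=
  (gens F).filter (fun V => V.card = 2)

theorem pair_mem_of_mem_graphNbrs {u x : α} (h : x ∈ graphNbrs (edgeGens F) u) : {u, x} ∈ F :=
  (mem_filter.1 (mem_filter.1 (mem_graphNbrs.1 h).2).1).1

theorem mem_piF_of_mem_graphNbrs {u x : α} {Z : Finset α} (h : x ∈ graphNbrs (edgeGens F) u)
    (hu : u ∈ Z) (hx : x ∈ Z) : u ∈ piF F Z :=
  mem_piF.2 ⟨_, pair_mem_of_mem_graphNbrs h, by simp [insert_subset_iff, hu, hx], by simp⟩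

/-- A point of `π_F(Z)` lying in `X` but not in `π_F(X)` has a neighbor in `Z` outside `X`. -/
theorem exists_graphNbrs_of_mem_piF (hgraph : ∀ V ∈ gens F, V.card = 1 ∨ V.card = 2)
    {X Z : Finset α} {x : α} (hxX : x ∈ X) (hx : x ∈ piF F Z) (hx' : x ∉ piF F X) :
    ∃ y ∈ Z, y ∉ X ∧ y ∈ graphNbrs (edgeGens F) x := by
  obtain ⟨P, hP, hPZ, hxP⟩ := mem_piF.1 hx
  obtain ⟨V, hV, hVP, hxV⟩ := exists_gens_of_mem hP hxP
  have hVX : ¬ V ⊆ X := fun h => hx' (mem_piF.2 ⟨V, (mem_filter.1 hV).1, h, hxV⟩)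
  obtain ⟨y, hyV, hyX⟩ := not_subset.1 hVX
  have hxy : x ≠ y := fun h => hyX (h ▸ hxX)
  have hsub : ({x, y} : Finset α) ⊆ V := by simp [insert_subset_iff, hxV, hyV]
  have hcard : #V = 2 := by
    rcases hgraph V hV with h | h
    · have := card_le_card hsub
      rw [card_pair hxy] at this
      omega
    · exact h
  have hVeq : ({x, y} : Finset α) = V := eq_of_subset_of_card_le hsub (by rw [hcard, card_pair hxy])
  exact ⟨y, hPZ (hVP hyV), hyX, mem_graphNbrs.2 ⟨hxy.symm, hVeq ▸ mem_filter.2 ⟨hV, hcard⟩⟩⟩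

/-- The graph neighbors of `c` outside `{a, b}`. -/
def outerNbrs (F : Finset (Finset α)) (a b c : α) : Finset α :=
  ((graphNbrs (edgeGens F) c).erase a).erase b

theorem outerNbrs_comm (a b : α) : outerNbrs F a b = outerNbrs F b a :=
  funext fun _ => erase_right_comm

theorem AllJoined.mem_piF {a b x : α} {C X : Finset α} (h : AllJoined (outerNbrs F a b) C X)
    (hxC : x ∈ C) (hxX : x ∈ X) : x ∈ piF F X := by
  obtain ⟨e, he⟩ := h x hxC hxX
  rw [mem_inter] at he
  exact mem_piF_of_mem_graphNbrs (mem_of_mem_erase (mem_of_mem_erase he.1)) hxX he.2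

theorem piF_mono {X Y : Finset α} (h : X ⊆ Y) : piF F X ⊆ piF F Y := by
  intro x hx
  obtain ⟨P, hP, hPX, hxP⟩ := mem_piF.1 hx
  exact mem_piF.2 ⟨P, hP, hPX.trans h, hxP⟩

variable {a b : α} {X : Finset α}

theorem empty_mem_Efam (hgraph : ∀ V ∈ gens F, V.card = 1 ∨ V.card = 2)
    (hX : Disjoint X {a, b})
    (hJ : AllJoined (outerNbrs F a b)
      ((graphNbrs (edgeGens F) a).erase b ∪ (graphNbrs (edgeGens F) b).erase a) X) :
    ∅ ∈ Efam F {a, b} X := by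
  rw [Efam, mem_filter, union_empty]
  refine ⟨empty_mem_powerset _, ?_, fun x hx => ?_⟩
  · rw [← disjoint_iff_inter_eq_empty]
    exact hX.mono_left (piF_subset F X)
  · rw [mem_sdiff] at hx
    have hxX : x ∈ X := (mem_union.1 (piF_subset _ _ hx.1)).resolve_right hx.2
    by_contra hx'
    obtain ⟨y, hyZ, hyX, hxy⟩ := exists_graphNbrs_of_mem_piF hgraph hxX hx.1 hx'
    have hyU := (mem_union.1 hyZ).resolve_left hyX
    simp only [mem_insert, mem_singleton, not_or] at hyU hx
    refine hx' (hJ.mem_piF ?_ hxX)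
    rw [mem_union, mem_erase, mem_erase]
    rcases hyU with rfl | rfl
    · exact Or.inl ⟨hx.2.2, mem_graphNbrs_comm.1 hxy⟩
    · exact Or.inr ⟨hx.2.1, mem_graphNbrs_comm.1 hxy⟩

theorem singleton_mem_Efam (hgraph : ∀ V ∈ gens F, V.card = 1 ∨ V.card = 2)
    (hX : Disjoint X {a, b}) (hXa : (X ∩ (graphNbrs (edgeGens F) a).erase b).Nonempty)
    (hJ : AllJoined (outerNbrs F a b)
      ((graphNbrs (edgeGens F) b).erase a \ (graphNbrs (edgeGens F) a).erase b) X) :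
    {a} ∈ Efam F {a, b} X := by
  rw [Efam, mem_filter]
  have haU : ({a} : Finset α) ⊆ {a, b} := by simp
  refine ⟨mem_powerset.2 haU, Subset.antisymm (fun x hx => ?_) (fun x hx => ?_), fun x hx => ?_⟩
  · rw [mem_inter] at hx
    exact (mem_union.1 (piF_subset _ _ hx.1)).resolve_left fun h => disjoint_left.1 hX h hx.2
  · obtain rfl := mem_singleton.1 hx
    obtain ⟨c, hc⟩ := hXa
    rw [mem_inter] at hc
    exact mem_inter.2 ⟨mem_piF_of_mem_graphNbrs (mem_of_mem_erase hc.2) (by simp)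
      (mem_union_left _ hc.1), haU hx⟩
  · rw [mem_sdiff] at hx
    have hxX : x ∈ X := (mem_union.1 (piF_subset _ _ hx.1)).resolve_right hx.2
    by_contra hx'
    obtain ⟨y, hyZ, hyX, hxy⟩ :=
      exists_graphNbrs_of_mem_piF hgraph (mem_union_left {a} hxX) hx.1 hx'
    have hxa : x ∉ graphNbrs (edgeGens F) a := fun h =>
      hx' (mem_piF_of_mem_graphNbrs (mem_graphNbrs_comm.1 h) (mem_union_left _ hxX) (by simp))
    simp only [mem_union, mem_insert, mem_singleton, not_or] at hyZ hyX hx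
    obtain rfl : y = b := by tauto
    refine hx' (piF_mono subset_union_left (hJ.mem_piF ?_ hxX))
    exact mem_sdiff.2 ⟨mem_erase.2 ⟨hx.2.1, mem_graphNbrs_comm.1 hxy⟩,
      fun h => hxa (mem_of_mem_erase h)⟩

theorem self_mem_Efam {U : Finset α} (hU : U ∈ F) : U ∈ Efam F U X := by
  rw [Efam, mem_filter]
  refine ⟨mem_powerset_self U, Subset.antisymm inter_subset_right fun x hx => ?_, sdiff_subset⟩
  exact mem_inter.2 ⟨mem_piF.2 ⟨U, hU, subset_union_right, hx⟩, hx⟩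

theorem traceCount_le_card_Efam (hgraph : ∀ V ∈ gens F, V.card = 1 ∨ V.card = 2)
    (hab : a ≠ b) (hU : {a, b} ∈ F) (hX : Disjoint X {a, b}) :
    traceCount (outerNbrs F a b) ((graphNbrs (edgeGens F) a).erase b)
      ((graphNbrs (edgeGens F) b).erase a) X ≤ #(Efam F {a, b} X) := by
  classical
  have h0 := empty_mem_Efam hgraph hX
  have ha := singleton_mem_Efam hgraph hX
  have hb := singleton_mem_Efam hgraph (pair_comm a b ▸ hX)
  rw [pair_comm b a, outerNbrs_comm] at hb
  have hsum : #(Efam F {a, b} X) = ∑ Y ∈ ({a, b} : Finset α).powerset,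
      if Y ∈ Efam F {a, b} X then 1 else 0 := by
    have hsub : Efam F {a, b} X ⊆ ({a, b} : Finset α).powerset := filter_subset _ _
    rw [← card_filter, filter_mem_eq_inter, inter_eq_right.2 hsub]
  rw [hsum]
  refine le_trans ?_ (sum_le_sum_of_subset
    (s := {{a, b}, ∅, {a}, {b}}) (by simp [insert_subset_iff]))
  have hpa : ({a, b} : Finset α) ≠ {a} := fun h =>
    hab.symm (by simpa using (Finset.ext_iff.1 h b).1)
  have hpb : ({a, b} : Finset α) ≠ {b} := fun h => hab (by simpa using (Finset.ext_iff.1 h a).1)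
  rw [sum_insert (by simp [hpa, hpb]), sum_insert (by simp),
    sum_insert (by simpa using hab), sum_singleton, if_pos (self_mem_Efam hU), traceCount]
  simp only [add_assoc]
  gcongr <;> split_ifs <;> simp_all

end Graph

/-- Theorem 3.29: with `J(F)` a graph, `U = {a, b} ∈ J(F)` (`a ≠ b`), and
`F = 𝒩³_F(U)`, if every edge `V ∈ J'(F)` meeting `U` has
`d_{J'(F)}(V) ≥ d_{J'(F)}(U)`, then every extension `F'` of `(F, U)` has
`μ_{F,F'}(U) ≥ 2`. -/
theorem stmt18 {α : Type*} [DecidableEq α] (F : Finset (Finset α))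
    (hUC : UnionClosed F) (hempty : ∅ ∈ F)
    (hgraph : ∀ V ∈ gens F, V.card = 1 ∨ V.card = 2)
    (a b : α) (hab : a ≠ b) (hU : ({a, b} : Finset α) ∈ gens F)
    (hN3 : F = latNbhd3 F {a, b})
    (hdeg : ∀ V ∈ (gens F).filter (fun V => V.card = 2),
      (V ∩ ({a, b} : Finset α)).Nonempty →
      degG ((gens F).filter (fun V => V.card = 2)) ({a, b} : Finset α) ≤
        degG ((gens F).filter (fun V => V.card = 2)) V) :
    ∀ F' : Finset (Finset α), IsExtension F ({a, b} : Finset α) F' →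
      (2 : ℚ) ≤ mu F ({a, b} : Finset α) F' := by
  rintro F' ⟨H, ⟨h₀, hh₀⟩, -, -, rfl⟩
  have hUF : ({a, b} : Finset α) ∈ F := (mem_filter.1 hU).1
  have hG : ∀ V ∈ edgeGens F, #V = 2 := fun V hV => (mem_filter.1 hV).2
  have hUG : ({a, b} : Finset α) ∈ edgeGens F := mem_filter.2 ⟨hU, card_pair hab⟩
  have hba : b ∈ graphNbrs (edgeGens F) a := mem_graphNbrs.2 ⟨hab.symm, hUG⟩
  set W := resAway (famJoin F H) {a, b} with hW
  set A := (graphNbrs (edgeGens F) a).erase b with hA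
  set B := (graphNbrs (edgeGens F) b).erase a with hB
  have hmem : ∀ X, X ∈ W ↔ ∃ P ∈ F, ∃ h ∈ H, (P ∪ h) \ {a, b} = X := by
    intro X
    simp only [hW, resAway, famJoin, mem_image, mem_product, Prod.exists]
    constructor
    · rintro ⟨_, ⟨P, h, ⟨hP, hh⟩, rfl⟩, rfl⟩
      exact ⟨P, hP, h, hh, rfl⟩
    · rintro ⟨P, hP, h, hh, rfl⟩
      exact ⟨_, ⟨P, h, ⟨hP, hh⟩, rfl⟩, rfl⟩
  have hjoin : ∀ X ∈ W, ∀ V ∈ F, X ∪ V \ {a, b} ∈ W := by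
    intro X hX V hV
    obtain ⟨P, hP, h, hh, rfl⟩ := (hmem X).1 hX
    refine (hmem _).2 ⟨P ∪ V, hUC P hP V hV, h, hh, ?_⟩
    rw [← union_sdiff_distrib, union_right_comm]
  have hNA : ∀ c ∈ A \ B, #B ≤ #(outerNbrs F a b c) := by
    intro c hc
    rw [mem_sdiff] at hc
    refine card_erase_le_card_graphNbrs hG hab hba hc.1 hc.2 (hdeg _ ?_ ⟨a, by simp⟩)
    exact (mem_graphNbrs.1 (mem_of_mem_erase hc.1)).2
  have hNB : ∀ c ∈ B \ A, #A ≤ #(outerNbrs F a b c) := by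
    intro c hc
    rw [mem_sdiff] at hc
    rw [outerNbrs_comm]
    refine card_erase_le_card_graphNbrs hG hab.symm (mem_graphNbrs_comm.1 hba) hc.1 hc.2 ?_
    rw [pair_comm b a]
    exact hdeg _ (mem_graphNbrs.1 (mem_of_mem_erase hc.1)).2 ⟨b, by simp⟩
  have hC : ∀ X ∈ W, ∀ e ∈ A ∪ B, insert e X ∈ W := by
    intro X hX e he
    rcases mem_union.1 he with he | he
    · obtain ⟨heb, he⟩ := mem_erase.1 he
      convert hjoin X hX _ (pair_mem_of_mem_graphNbrs he) using 1
      have hea := (mem_graphNbrs.1 he).1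
      ext x
      simp only [mem_insert, mem_union, mem_sdiff, mem_singleton]
      grind
    · obtain ⟨hea, he⟩ := mem_erase.1 he
      convert hjoin X hX _ (pair_mem_of_mem_graphNbrs he) using 1
      have heb := (mem_graphNbrs.1 he).1
      ext x
      simp only [mem_insert, mem_union, mem_sdiff, mem_singleton]
      grind
  have hN : ∀ X ∈ W, ∀ c ∈ A ∪ B, c ∈ X → ∀ e ∈ outerNbrs F a b c, insert e X ∈ W := by
    intro X hX c _ hcX e he
    obtain ⟨heb, he⟩ := mem_erase.1 he
    obtain ⟨hea, he⟩ := mem_erase.1 he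
    convert hjoin X hX _ (pair_mem_of_mem_graphNbrs he) using 1
    ext x
    simp only [mem_insert, mem_union, mem_sdiff, mem_singleton]
    grind
  have hpos : 0 < #W := card_pos.2 ⟨_, (hmem _).2 ⟨∅, hempty, h₀, hh₀, rfl⟩⟩
  have hsum : 2 * #W ≤ ∑ X ∈ W, #(Efam F {a, b} X) := by
    refine (two_mul_card_le_sum_traceCount hNA hNB W hC hN).trans (sum_le_sum fun X hX => ?_)
    obtain ⟨P, -, h, -, rfl⟩ := (hmem X).1 hX
    exact traceCount_le_card_Efam hgraph hab hUF sdiff_disjoint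
  rw [mu, le_div_iff₀ (by exact_mod_cast hpos)]
  exact_mod_cast hsum
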